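/- Let n ≥ 1, 0 < p < ∞ and λ > max(2/p, 1). There is a constant C > 0 depending only on n, p and λ such that for every locally square integrable function g on (0,∞)×ℝⁿ, ‖ G_λ g ‖_{L^p(ℝⁿ)} ≤ C ‖A^{(1)}g‖_{L^p(ℝⁿ)}, where G_λ g(x) = ( ∫_{(0,∞)×ℝⁿ} ( t/(|x−y|+t) )^{nλ} |g(t,y)|² dy dt / t^{n+1} )^{1/2} is the grand square function. -/

import Mathlib

open MeasureTheory Metric Set Filter ENNReal

noncomputable section

/-- `ℝⁿ` as a Euclidean space. -/
abbrev En (n : ℕ) : Type := EuclideanSpace ℝ (Fin n)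

/-- `g` is (measurable and) locally square integrable on `(0,∞) × ℝⁿ`. -/
def LocSqInt (n : ℕ) (g : ℝ → En n → ℝ) : Prop :=
  Measurable (Function.uncurry g) ∧
  LocallyIntegrableOn (fun q : ℝ × En n => (g q.1 q.2) ^ 2)
    (Set.Ioi (0 : ℝ) ×ˢ (Set.univ : Set (En n)))

/-- The conical square function `A^{(α)} g (x)` of aperture `α`, with values in `[0,∞]`. -/
def conicalSq (n : ℕ) (α : ℝ) (g : ℝ → En n → ℝ) (x : En n) : ℝ≥0∞ :=
  (∫⁻ t in Set.Ioi (0 : ℝ), ∫⁻ y,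
      (ball x (α * t)).indicator (fun y => ENNReal.ofReal (|g t y| ^ 2 / t ^ (n + 1))) y) ^
    (1 / 2 : ℝ)

/-- The tent space quasi-norm `‖g‖_{T^{p,2}_α} = ‖A^{(α)} g‖_{L^p(ℝⁿ)}`, with values in `[0,∞]`. -/
def tentNorm (n : ℕ) (p α : ℝ) (g : ℝ → En n → ℝ) : ℝ≥0∞ :=
  (∫⁻ x, conicalSq n α g x ^ p) ^ (1 / p)

/-- The vertical square function `V g (x)`. -/
def vertSq (n : ℕ) (g : ℝ → En n → ℝ) (x : En n) : ℝ≥0∞ :=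
  (∫⁻ t in Set.Ioi (0 : ℝ), ENNReal.ofReal (|g t x| ^ 2 / t)) ^ (1 / 2 : ℝ)

/-- `‖V g‖_{L^p(ℝⁿ)}`, with values in `[0,∞]`. -/
def vertNorm (n : ℕ) (p : ℝ) (g : ℝ → En n → ℝ) : ℝ≥0∞ :=
  (∫⁻ x, vertSq n g x ^ p) ^ (1 / p)

/-- The tent `T_α B` of aperture `α` above the ball `B = B(x,r)`. -/
def tent (n : ℕ) (α : ℝ) (x : En n) (r : ℝ) : Set (ℝ × En n) :=
  {q | 0 < q.1 ∧ q.1 < r / α ∧ q.2 ∈ ball x (r - α * q.1)}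

/-- `∫_{T_α B} |g(t,y)|² dy dt / t`. -/
def tentIntegral (n : ℕ) (α : ℝ) (g : ℝ → En n → ℝ) (x : En n) (r : ℝ) : ℝ≥0∞ :=
  ∫⁻ q in tent n α x r, ENNReal.ofReal (|g q.1 q.2| ^ 2 / q.1)

/-- A `T^{p,2}_α`-atom associated with the ball `B(x,r)`: it is supported in the tent
`T_α B(x,r)` and satisfies `∫_{T_α B} |a|² dy dt/t ≤ α^{-n} |B|^{-(2/p - 1)}`. -/
def IsTentAtom (n : ℕ) (p α : ℝ) (a : ℝ → En n → ℝ) (x : En n) (r : ℝ) : Prop :=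
  (∀ t y, (t, y) ∉ tent n α x r → a t y = 0) ∧
  tentIntegral n α a x r ≤
    ENNReal.ofReal (α ^ (-(n : ℝ))) * volume (ball x r) ^ (-(2 / p - 1))

/-- The grand square function `G_λ g (x)` with exponent `nλ`. -/
def grandSq (n : ℕ) (l : ℝ) (g : ℝ → En n → ℝ) (x : En n) : ℝ≥0∞ :=
  (∫⁻ t in Set.Ioi (0 : ℝ), ∫⁻ y,
      ENNReal.ofReal ((t / (dist x y + t)) ^ ((n : ℝ) * l) * |g t y| ^ 2 / t ^ (n + 1))) ^
    (1 / 2 : ℝ)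

open Module Topology

section LayerCake

lemma setLIntegral_Ioo_rpow {q : ℝ} (hq : 0 < q) {c : ℝ} (hc : 0 ≤ c) :
    ∫⁻ s in Ioo 0 c, ENNReal.ofReal (s ^ (q - 1)) = ENNReal.ofReal (c ^ q / q) := by
  have hint : IntervalIntegrable (fun s : ℝ => s ^ (q - 1)) volume 0 c :=
    intervalIntegral.intervalIntegrable_rpow' (by linarith)
  rw [setLIntegral_congr Ioo_ae_eq_Ioc, ← ofReal_integral_eq_lintegral_ofReal,
    ← intervalIntegral.integral_of_le hc, integral_rpow (Or.inl (by linarith))]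
  · simp [hq.ne']
  · exact (intervalIntegrable_iff_integrableOn_Ioc_of_le hc).1 hint
  · filter_upwards [ae_restrict_mem measurableSet_Ioc] with s hs
    exact Real.rpow_nonneg hs.1.le _

/-- The value of the lower power integral that underlies the layer cake formula. -/
lemma setLIntegral_lt_rpow {q : ℝ} (hq : 0 < q) (c : ℝ≥0∞) :
    ∫⁻ s in Ioi (0 : ℝ), {s : ℝ | ENNReal.ofReal s < c}.indicator
      (fun s => ENNReal.ofReal (s ^ (q - 1))) s = c ^ q / ENNReal.ofReal q := by
  have hfin : ∀ c : ℝ, 0 ≤ c → ∫⁻ s in Ioi (0 : ℝ),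
      {s : ℝ | ENNReal.ofReal s < ENNReal.ofReal c}.indicator
        (fun s => ENNReal.ofReal (s ^ (q - 1))) s = ENNReal.ofReal (c ^ q / q) := by
    intro c hc
    rw [setLIntegral_indicator (measurableSet_lt (by fun_prop) (by fun_prop)),
      ← setLIntegral_Ioo_rpow hq hc]
    congr 2
    ext s
    simp only [mem_inter_iff, mem_ofPred_eq, mem_Ioi, mem_Ioo]
    constructor
    · rintro ⟨h1, h2⟩
      exact ⟨h2, (ENNReal.ofReal_lt_ofReal_iff_of_nonneg h2.le).1 h1⟩
    · rintro ⟨h1, h2⟩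
      exact ⟨(ENNReal.ofReal_lt_ofReal_iff_of_nonneg h1.le).2 h2, h1⟩
  rcases eq_or_ne c ∞ with rfl | hc
  · rw [ENNReal.top_rpow_of_pos hq, ENNReal.top_div_of_ne_top (by simp)]
    refine ENNReal.eq_top_of_forall_nnreal_le fun r => ?_
    have hr : (r : ℝ≥0∞) = ENNReal.ofReal ((((r : ℝ) * q) ^ q⁻¹) ^ q / q) := by
      rw [← Real.rpow_mul (by positivity), inv_mul_cancel₀ hq.ne', Real.rpow_one,
        mul_div_cancel_right₀ _ hq.ne', ENNReal.ofReal_coe_nnreal]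
    rw [hr, ← hfin _ (by positivity)]
    refine lintegral_mono fun s => indicator_le_indicator_of_subset ?_ (by simp) s
    intro s _
    exact ENNReal.ofReal_lt_top
  · lift c to NNReal using hc
    have := hfin c c.2
    rw [ENNReal.ofReal_coe_nnreal] at this
    rw [this, ENNReal.ofReal_div_of_pos hq, ← ENNReal.ofReal_rpow_of_nonneg c.coe_nonneg hq.le,
      ENNReal.ofReal_coe_nnreal]

/-- The upper power integral, valid also when `c` is `0` or `∞`. -/
lemma mul_setLIntegral_ge_rpow {q : ℝ} (hq1 : q < 1) (c : ℝ≥0∞) :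
    c * ∫⁻ s in Ioi (0 : ℝ), {s : ℝ | c ≤ ENNReal.ofReal s}.indicator
      (fun s => ENNReal.ofReal (s ^ (q - 2))) s ≤ c ^ q / ENNReal.ofReal (1 - q) := by
  rcases eq_or_ne c ∞ with rfl | hc
  · simp
  lift c to NNReal using hc
  rcases eq_or_ne c 0 with rfl | hc0
  · simp
  have hc0 : 0 < (c : ℝ) := by positivity
  rw [setLIntegral_indicator (measurableSet_le (by fun_prop) (by fun_prop))]
  have hset : {s : ℝ | (c : ℝ≥0∞) ≤ ENNReal.ofReal s} ∩ Ioi 0 = Ici (c : ℝ) := by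
    ext s
    simp only [mem_inter_iff, mem_ofPred_eq, mem_Ioi, mem_Ici]
    constructor
    · rintro ⟨h1, h2⟩
      rw [← ENNReal.ofReal_coe_nnreal] at h1
      exact (ENNReal.ofReal_le_ofReal_iff h2.le).1 h1
    · intro h
      rw [← ENNReal.ofReal_coe_nnreal]
      exact ⟨ENNReal.ofReal_le_ofReal h, hc0.trans_le h⟩
  rw [hset, setLIntegral_congr Ioi_ae_eq_Ici.symm, ← ofReal_integral_eq_lintegral_ofReal
    (integrableOn_Ioi_rpow_of_lt (by linarith) hc0), integral_Ioi_rpow_of_lt (by linarith) hc0]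
  · rw [← ENNReal.ofReal_coe_nnreal, ENNReal.ofReal_rpow_of_pos hc0,
      ← ENNReal.ofReal_mul hc0.le, ← ENNReal.ofReal_div_of_pos (by linarith)]
    apply ENNReal.ofReal_le_ofReal
    have : (c : ℝ) ^ q = c * (c : ℝ) ^ (q - 2 + 1) := by
      rw [show q - 2 + 1 = q - 1 by ring, Real.rpow_sub_one hc0.ne']
      field_simp
    rw [this, show q - 2 + 1 = -(1 - q) by ring, neg_div_neg_eq, mul_div_assoc]
  · filter_upwards [ae_restrict_mem measurableSet_Ioi] with s hs
    exact Real.rpow_nonneg (hc0.le.trans (le_of_lt hs)) _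

/-- The layer cake formula for functions with values in `[0,∞]`. -/
lemma lintegral_rpow_eq_layercake {α : Type*} [MeasurableSpace α] {μ : Measure α} [SFinite μ]
    {f : α → ℝ≥0∞} (hf : Measurable f) {q : ℝ} (hq : 0 < q) :
    ∫⁻ x, f x ^ q ∂μ = ENNReal.ofReal q *
      ∫⁻ s in Ioi (0 : ℝ), ENNReal.ofReal (s ^ (q - 1)) * μ {x | ENNReal.ofReal s < f x} := by
  have hq0 : ENNReal.ofReal q ≠ 0 := by simpa using hq
  have h1 : ∀ x, f x ^ q = ENNReal.ofReal q * ∫⁻ s in Ioi (0 : ℝ),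
      {s : ℝ | ENNReal.ofReal s < f x}.indicator (fun s => ENNReal.ofReal (s ^ (q - 1))) s := by
    intro x
    rw [setLIntegral_lt_rpow hq, ENNReal.mul_div_cancel hq0 (by simp)]
  have hS : MeasurableSet {z : α × ℝ | ENNReal.ofReal z.2 < f z.1} :=
    measurableSet_lt (by fun_prop) (by fun_prop)
  have hm : Measurable (Function.uncurry fun (x : α) (s : ℝ) =>
      {s : ℝ | ENNReal.ofReal s < f x}.indicator (fun s => ENNReal.ofReal (s ^ (q - 1))) s) := by
    have : Measurable fun z : α × ℝ => ENNReal.ofReal (z.2 ^ (q - 1)) := by fun_prop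
    exact this.indicator hS
  simp_rw [h1]
  rw [lintegral_const_mul' _ _ (by simp), lintegral_lintegral_swap hm.aemeasurable]
  congr 1
  refine lintegral_congr fun s => ?_
  have : ∀ x, {s : ℝ | ENNReal.ofReal s < f x}.indicator
      (fun s => ENNReal.ofReal (s ^ (q - 1))) s =
      {x | ENNReal.ofReal s < f x}.indicator (fun _ => ENNReal.ofReal (s ^ (q - 1))) x := by
    intro x
    simp [indicator]
  simp_rw [this]
  rw [lintegral_indicator_const (measurableSet_lt (by fun_prop) hf)]

end LayerCake

section Duality

lemma ENNReal.mul_rpow_sub_one_self {q : ℝ} (hq : 1 ≤ q) (c : ℝ≥0∞) : c * c ^ (q - 1) = c ^ q := by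
  conv_lhs => rw [← ENNReal.rpow_one c, ← ENNReal.rpow_mul, one_mul]
  rw [← ENNReal.rpow_add_of_nonneg _ _ (by norm_num) (by linarith)]
  congr 1
  ring

lemma ENNReal.rpow_tsum_le_tsum_rpow {q : ℝ} (hq : 0 < q) (hq1 : q ≤ 1) (f : ℕ → ℝ≥0∞) :
    (∑' j, f j) ^ q ≤ ∑' j, f j ^ q := by
  have h1 : ∀ k, (∑ j ∈ Finset.range k, f j) ^ q ≤ ∑ j ∈ Finset.range k, f j ^ q := by
    intro k
    induction k with
    | zero => simp [hq]
    | succ k ih =>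
      rw [Finset.sum_range_succ, Finset.sum_range_succ]
      exact (ENNReal.rpow_add_le_add_rpow _ _ hq.le hq1).trans (by gcongr)
  have h2 : Tendsto (fun k => (∑ j ∈ Finset.range k, f j) ^ q) atTop (𝓝 ((∑' j, f j) ^ q)) :=
    (ENNReal.continuous_rpow_const.tendsto _).comp (ENNReal.tendsto_nat_tsum f)
  exact le_of_tendsto' h2 fun k => (h1 k).trans (ENNReal.sum_le_tsum _)

/-- If `∫ G h ≤ N ‖h‖_{q'}` for all measurable `h ≥ 0`, then `‖G‖_q ≤ N`. -/
lemma lintegral_rpow_le_of_forall_mul_le {α : Type*} [MeasurableSpace α] {μ : Measure α}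
    [SigmaFinite μ] {q q' : ℝ} (hqq : q.HolderConjugate q') {G : α → ℝ≥0∞} (hG : Measurable G)
    {N : ℝ≥0∞}
    (hN : ∀ h : α → ℝ≥0∞, Measurable h → ∫⁻ x, G x * h x ∂μ ≤ N * (∫⁻ x, h x ^ q' ∂μ) ^ (1 / q')) :
    ∫⁻ x, G x ^ q ∂μ ≤ N ^ q := by
  have hq : 1 < q := hqq.lt
  have hq0 : 0 < q := hqq.pos
  have hq'0 : 0 < q' := hqq.symm.pos
  set g : ℕ → α → ℝ≥0∞ := fun k => (spanningSets μ k).indicator fun x => min (G x) k with hg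
  have hgm : ∀ k, Measurable (g k) := fun k =>
    (hG.min measurable_const).indicator (measurableSet_spanningSets μ k)
  have hgG : ∀ k x, g k x ≤ G x := fun k x =>
    (indicator_le_self _ _ x).trans (min_le_left _ _)
  have hbound : ∀ k, ∫⁻ x, g k x ^ q ∂μ ≤ N ^ q := by
    intro k
    set I := ∫⁻ x, g k x ^ q ∂μ with hI
    have hfin : I ≠ ∞ := by
      refine ne_top_of_le_ne_top (b := (k : ℝ≥0∞) ^ q * μ (spanningSets μ k)) ?_ ?_
      · exact ENNReal.mul_ne_top (by finiteness) (measure_spanningSets_lt_top μ k).ne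
      · rw [← lintegral_indicator_const (measurableSet_spanningSets μ k)]
        refine lintegral_mono fun x => ?_
        by_cases hx : x ∈ spanningSets μ k
        · simp only [hg, indicator_of_mem hx]
          gcongr
          exact min_le_right _ _
        · simp [hg, indicator_of_notMem hx, hq0]
    rcases eq_or_ne I 0 with h0 | h0
    · rw [h0]; exact zero_le
    have h1 : I ≤ N * I ^ (1 / q') := by
      have := hN (fun x => g k x ^ (q - 1)) ((hgm k).pow_const _)
      have h2 : ∀ x, (g k x ^ (q - 1)) ^ q' = g k x ^ q := fun x => by
        rw [← ENNReal.rpow_mul, hqq.sub_one_mul_conj]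
      simp_rw [h2] at this
      refine le_trans (lintegral_mono fun x => ?_) this
      rw [← ENNReal.mul_rpow_sub_one_self hq.le]
      gcongr
      exact hgG k x
    have h3 : I = I ^ (1 / q) * I ^ (1 / q') := by
      rw [← ENNReal.rpow_add _ _ h0 hfin, one_div, one_div, hqq.inv_add_inv_eq_one,
        ENNReal.rpow_one]
    have h4 : I ^ (1 / q) ≤ N := by
      refine (ENNReal.mul_le_mul_iff_left (c := I ^ (1 / q')) ?_ ?_).1 (by rwa [← h3])
      · simp [h0, hfin]
      · finiteness
    calc I = (I ^ (1 / q)) ^ q := by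
          rw [← ENNReal.rpow_mul, one_div_mul_cancel hq0.ne', ENNReal.rpow_one]
      _ ≤ N ^ q := by gcongr
  have hlim : ∀ x, Tendsto (fun k => g k x ^ q) atTop (𝓝 (G x ^ q)) := by
    intro x
    refine (ENNReal.continuous_rpow_const.tendsto _).comp ?_
    have h1 : Tendsto (fun k : ℕ => min (G x) (k : ℝ≥0∞)) atTop (𝓝 (min (G x) ∞)) :=
      tendsto_const_nhds.min ENNReal.tendsto_nat_nhds_top
    rw [min_eq_left le_top] at h1
    refine h1.congr' ?_
    filter_upwards [eventually_ge_atTop (spanningSetsIndex μ x)] with k hk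
    exact (indicator_of_mem (f := fun x => min (G x) k)
      (mem_spanningSets_of_index_le μ x hk)).symm
  calc ∫⁻ x, G x ^ q ∂μ = ∫⁻ x, liminf (fun k => g k x ^ q) atTop ∂μ :=
        lintegral_congr fun x => (hlim x).liminf_eq.symm
    _ ≤ liminf (fun k => ∫⁻ x, g k x ^ q ∂μ) atTop :=
        lintegral_liminf_le fun k => (hgm k).pow_const _
    _ ≤ N ^ q := liminf_le_of_le (by isBoundedDefault) fun b hb =>
        let ⟨k, hk⟩ := hb.exists
        hk.trans (hbound k)

end Duality

section MaximalFunction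

variable {E : Type*} [NormedAddCommGroup E] [MeasurableSpace E]

/-- The uncentered Hardy–Littlewood maximal function. -/
def maximalFn (μ : Measure E) (h : E → ℝ≥0∞) (x : E) : ℝ≥0∞ :=
  ⨆ (b : E × ℝ) (_ : x ∈ ball b.1 b.2), (μ (ball b.1 b.2))⁻¹ * ∫⁻ z in ball b.1 b.2, h z ∂μ

lemma laverage_ball_le_maximalFn {μ : Measure E} {h : E → ℝ≥0∞} {x y : E} {r : ℝ}
    (hx : x ∈ ball y r) :
    (μ (ball y r))⁻¹ * ∫⁻ z in ball y r, h z ∂μ ≤ maximalFn μ h x :=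
  le_iSup₂_of_le (y, r) hx le_rfl

lemma lt_maximalFn_iff {μ : Measure E} {h : E → ℝ≥0∞} {x : E} {s : ℝ≥0∞} :
    s < maximalFn μ h x ↔ ∃ b : E × ℝ, x ∈ ball b.1 b.2 ∧
      s < (μ (ball b.1 b.2))⁻¹ * ∫⁻ z in ball b.1 b.2, h z ∂μ := by
  simp [maximalFn, lt_iSup_iff]

lemma measurable_maximalFn [BorelSpace E] (μ : Measure E) (h : E → ℝ≥0∞) :
    Measurable (maximalFn μ h) := by
  refine measurable_of_Ioi fun s => IsOpen.measurableSet ?_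
  rw [isOpen_iff_mem_nhds]
  intro x hx
  obtain ⟨b, hb, hs⟩ := lt_maximalFn_iff.1 (show s < maximalFn μ h x from hx)
  filter_upwards [isOpen_ball.mem_nhds hb] with z hz
  exact lt_maximalFn_iff.2 ⟨b, hz, hs⟩

variable [NormedSpace ℝ E] [FiniteDimensional ℝ E] (μ : Measure E) [μ.IsAddHaarMeasure]

lemma setLIntegral_ball_le_mul_maximalFn {h : E → ℝ≥0∞} {x y : E} {r : ℝ} (hx : x ∈ ball y r) :
    ∫⁻ z in ball y r, h z ∂μ ≤ μ (ball y r) * maximalFn μ h x := by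
  have h0 : μ (ball y r) ≠ 0 := (measure_ball_pos μ y (pos_of_mem_ball hx)).ne'
  have ht : μ (ball y r) ≠ ∞ := measure_ball_lt_top.ne
  calc ∫⁻ z in ball y r, h z ∂μ
      = μ (ball y r) * ((μ (ball y r))⁻¹ * ∫⁻ z in ball y r, h z ∂μ) := by
        rw [← mul_assoc, ENNReal.mul_inv_cancel h0 ht, one_mul]
    _ ≤ _ := by gcongr; exact laverage_ball_le_maximalFn hx

variable [BorelSpace E] [Nontrivial E]

/-- A Vitali covering bound for a family of balls on which `h` has large averages. -/
lemma measure_biUnion_ball_le {h : E → ℝ≥0∞} {s : ℝ≥0∞} (hs : s ≠ 0)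
    (hint : ∫⁻ z, h z ∂μ ≠ ∞) (T : Set (E × ℝ))
    (hT : ∀ b ∈ T, 0 < b.2 ∧ s * μ (ball b.1 b.2) ≤ ∫⁻ z in ball b.1 b.2, h z ∂μ) :
    s * μ (⋃ b ∈ T, ball b.1 b.2) ≤ ENNReal.ofReal (5 ^ finrank ℝ E) * ∫⁻ z, h z ∂μ := by
  set I := ∫⁻ z, h z ∂μ with hI
  have hd : finrank ℝ E ≠ 0 := finrank_pos.ne'
  have hc0 : μ (ball (0 : E) 1) ≠ 0 := (measure_ball_pos μ 0 one_pos).ne'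
  set K := I / (s * μ (ball (0 : E) 1)) with hK
  have hKtop : K ≠ ∞ := ENNReal.div_ne_top hint (mul_ne_zero hs hc0)
  have hrad : ∀ b ∈ T, b.2 ≤ 1 + K.toReal := by
    intro b hb
    obtain ⟨hr, hb⟩ := hT b hb
    rw [Measure.addHaar_ball μ _ hr.le] at hb
    have h1 : ENNReal.ofReal (b.2 ^ finrank ℝ E) ≤ K := by
      rcases eq_or_ne s ∞ with rfl | hst
      · exfalso
        have := hb.trans (setLIntegral_le_lintegral _ _)
        rw [ENNReal.top_mul (by simp [hc0]; positivity)] at this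
        exact hint (top_le_iff.1 this)
      rw [hK, ENNReal.le_div_iff_mul_le (Or.inl (mul_ne_zero hs hc0))
        (Or.inl (ENNReal.mul_ne_top hst measure_ball_lt_top.ne))]
      calc _ = s * (ENNReal.ofReal (b.2 ^ finrank ℝ E) * μ (ball 0 1)) := by ring
        _ ≤ _ := hb.trans (setLIntegral_le_lintegral _ _)
    have h2 := (ENNReal.ofReal_le_iff_le_toReal hKtop).1 h1
    rcases le_total b.2 1 with h3 | h3
    · linarith [ENNReal.toReal_nonneg (a := K)]
    · linarith [le_self_pow₀ h3 hd]
  obtain ⟨u, huT, hdisj, hcov⟩ := Vitali.exists_disjoint_subfamily_covering_enlargement_closedBall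
    T (fun b => b.1) (fun b => b.2) _ hrad 5 (by norm_num)
  have hcount : u.Countable := hdisj.countable_of_nonempty_interior fun b hb => by
    have := (hT b (huT hb)).1
    exact ⟨b.1, interior_mono ball_subset_closedBall (by
      rw [isOpen_ball.interior_eq]; exact mem_ball_self this)⟩
  have hdisj' : u.PairwiseDisjoint fun b => ball b.1 b.2 :=
    hdisj.mono fun b => ball_subset_closedBall
  have hsub : (⋃ b ∈ T, ball b.1 b.2) ⊆ ⋃ b ∈ u, closedBall b.1 (5 * b.2) := by
    refine iUnion₂_subset fun b hb => ?_
    obtain ⟨c, hc, hbc⟩ := hcov b hb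
    exact (ball_subset_closedBall.trans hbc).trans
      (subset_biUnion_of_mem (u := fun c : E × ℝ => closedBall c.1 (5 * c.2)) hc)
  have : Countable u := hcount.to_subtype
  calc s * μ (⋃ b ∈ T, ball b.1 b.2)
      ≤ s * ∑' b : u, μ (closedBall b.1.1 (5 * b.1.2)) := by
        gcongr
        exact (measure_mono hsub).trans (measure_biUnion_le μ hcount _)
    _ = ∑' b : u, ENNReal.ofReal (5 ^ finrank ℝ E) * (s * μ (ball b.1.1 b.1.2)) := by
        rw [← ENNReal.tsum_mul_left]
        congr 1 with b
        have hb := (hT b.1 (huT b.2)).1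
        rw [Measure.addHaar_closedBall μ _ (by positivity), Measure.addHaar_ball μ _ hb.le,
          mul_pow, ENNReal.ofReal_mul (by positivity)]
        ring
    _ ≤ ∑' b : u, ENNReal.ofReal (5 ^ finrank ℝ E) * ∫⁻ z in ball b.1.1 b.1.2, h z ∂μ := by
        gcongr with b
        exact (hT b.1 (huT b.2)).2
    _ = ENNReal.ofReal (5 ^ finrank ℝ E) * ∫⁻ z in ⋃ b ∈ u, ball b.1 b.2, h z ∂μ := by
        rw [ENNReal.tsum_mul_left, lintegral_biUnion hcount (fun _ _ => measurableSet_ball) hdisj']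
    _ ≤ _ := by gcongr; exact setLIntegral_le_lintegral _ _

/-- The weak type `(1,1)` inequality for the truncation of `h` at height `s / 2`. -/
lemma mul_measure_lt_maximalFn_le {h : E → ℝ≥0∞} {s : ℝ≥0∞} (hs : s ≠ 0)
    (hs' : s ≠ ∞) :
    s * μ {x | s < maximalFn μ h x} ≤
      2 * ENNReal.ofReal (5 ^ finrank ℝ E) * ∫⁻ z, {z | s < 2 * h z}.indicator h z ∂μ := by
  set f := {z | s < 2 * h z}.indicator h with hf
  have hs2 : s / 2 ≠ 0 := by simp [hs]
  rcases eq_or_ne (∫⁻ z, f z ∂μ) ∞ with htop | htop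
  · rw [htop, ENNReal.mul_top (by simp)]
    exact le_top
  have hle : ∀ z, h z ≤ f z + s / 2 := by
    intro z
    by_cases hz : s < 2 * h z
    · rw [hf, indicator_of_mem (by exact hz)]
      exact le_self_add
    · rw [hf, indicator_of_notMem (by exact hz), zero_add,
        ENNReal.le_div_iff_mul_le (by simp) (by simp), mul_comm]
      exact not_lt.1 hz
  have hball : ∀ b : E × ℝ, s < (μ (ball b.1 b.2))⁻¹ * ∫⁻ z in ball b.1 b.2, h z ∂μ →
      0 < b.2 ∧ s / 2 * μ (ball b.1 b.2) ≤ ∫⁻ z in ball b.1 b.2, f z ∂μ := by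
    intro b hb
    have hr : 0 < b.2 := by
      by_contra hr
      simp [ball_eq_empty.2 (not_lt.1 hr)] at hb
    refine ⟨hr, ?_⟩
    have h0 : μ (ball b.1 b.2) ≠ 0 := (measure_ball_pos μ _ hr).ne'
    have ht : μ (ball b.1 b.2) ≠ ∞ := measure_ball_lt_top.ne
    have h1 : s * μ (ball b.1 b.2) ≤ ∫⁻ z in ball b.1 b.2, h z ∂μ := by
      rw [← ENNReal.le_div_iff_mul_le (Or.inl h0) (Or.inl ht), div_eq_mul_inv, mul_comm]
      exact hb.le
    have h2 : ∫⁻ z in ball b.1 b.2, h z ∂μ ≤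
        ∫⁻ z in ball b.1 b.2, f z ∂μ + s / 2 * μ (ball b.1 b.2) := by
      calc _ ≤ ∫⁻ z in ball b.1 b.2, (f z + s / 2) ∂μ := lintegral_mono hle
        _ = _ := by rw [lintegral_add_right _ measurable_const, setLIntegral_const]
    have h3 : s / 2 * μ (ball b.1 b.2) ≠ ∞ :=
      ENNReal.mul_ne_top (ENNReal.div_ne_top hs' (by simp)) ht
    refine (ENNReal.add_le_add_iff_right h3).1 ?_
    rw [← add_mul, ENNReal.add_halves]
    exact h1.trans h2
  have key := measure_biUnion_ball_le μ hs2 htop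
    {b | s < (μ (ball b.1 b.2))⁻¹ * ∫⁻ z in ball b.1 b.2, h z ∂μ} hball
  have hset : {x | s < maximalFn μ h x} ⊆
      ⋃ b ∈ {b : E × ℝ | s < (μ (ball b.1 b.2))⁻¹ * ∫⁻ z in ball b.1 b.2, h z ∂μ},
        ball b.1 b.2 := by
    intro x hx
    obtain ⟨b, hb, hs⟩ := lt_maximalFn_iff.1 hx
    exact mem_biUnion hs hb
  calc s * μ {x | s < maximalFn μ h x} = 2 * (s / 2 * μ {x | s < maximalFn μ h x}) := by
        rw [← mul_assoc, ENNReal.mul_div_cancel (by simp) (by simp)]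
    _ ≤ _ := by
      rw [mul_assoc]
      exact mul_le_mul' le_rfl (le_trans (mul_le_mul' le_rfl (measure_mono hset)) key)

/-- The strong type `(q,q)` inequality for the maximal function, `1 < q < ∞`. -/
lemma lintegral_maximalFn_rpow_le {q : ℝ} (hq : 1 < q) :
    ∃ C : ℝ≥0∞, C ≠ ∞ ∧ ∀ h : E → ℝ≥0∞, Measurable h →
      ∫⁻ x, maximalFn μ h x ^ q ∂μ ≤ C * ∫⁻ x, h x ^ q ∂μ := by
  set D : ℝ≥0∞ := 2 * ENNReal.ofReal (5 ^ finrank ℝ E) with hD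
  refine ⟨ENNReal.ofReal q * (D * (2 ^ (q - 1) / ENNReal.ofReal (q - 1))), ?_, ?_⟩
  · refine ENNReal.mul_ne_top (by simp) (ENNReal.mul_ne_top (by finiteness)
      (ENNReal.div_ne_top (by finiteness) (by simpa using hq)))
  intro h hh
  have hS : MeasurableSet {z : E × ℝ | ENNReal.ofReal z.2 < 2 * h z.1} :=
    measurableSet_lt (by fun_prop) (by fun_prop)
  have hm : Measurable (Function.uncurry fun (x : E) (s : ℝ) => h x *
      {s : ℝ | ENNReal.ofReal s < 2 * h x}.indicator
        (fun s => ENNReal.ofReal (s ^ (q - 1 - 1))) s) := by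
    have : Measurable fun z : E × ℝ => ENNReal.ofReal (z.2 ^ (q - 1 - 1)) := by fun_prop
    exact (hh.comp measurable_fst).mul (this.indicator hS)
  rw [lintegral_rpow_eq_layercake (measurable_maximalFn μ h) (by linarith), mul_assoc]
  gcongr
  calc ∫⁻ s in Ioi (0 : ℝ), ENNReal.ofReal (s ^ (q - 1)) *
        μ {x | ENNReal.ofReal s < maximalFn μ h x}
      ≤ ∫⁻ s in Ioi (0 : ℝ), D * ∫⁻ x, h x * {s : ℝ | ENNReal.ofReal s < 2 * h x}.indicator
          (fun s => ENNReal.ofReal (s ^ (q - 1 - 1))) s ∂μ := by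
        refine setLIntegral_mono' measurableSet_Ioi fun s (hs : 0 < s) => ?_
        have h1 : s ^ (q - 1) = s ^ (q - 1 - 1) * s := by
          rw [Real.rpow_sub_one hs.ne' (q - 1), div_mul_cancel₀ _ hs.ne']
        have h2 := mul_measure_lt_maximalFn_le μ (h := h) (s := ENNReal.ofReal s) (by simpa using hs)
          (by simp)
        rw [h1, ENNReal.ofReal_mul (by positivity), mul_assoc]
        refine (mul_le_mul' le_rfl h2).trans (le_of_eq ?_)
        rw [mul_left_comm, ← lintegral_const_mul' _ _ (by simp)]
        congr 1
        refine lintegral_congr fun x => ?_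
        simp only [indicator, mem_ofPred_eq]
        split_ifs <;> simp [mul_comm]
    _ = D * ∫⁻ x, h x * (∫⁻ s in Ioi (0 : ℝ), {s : ℝ | ENNReal.ofReal s < 2 * h x}.indicator
          (fun s => ENNReal.ofReal (s ^ (q - 1 - 1))) s) ∂μ := by
        rw [lintegral_const_mul' _ _ (by finiteness), ← lintegral_lintegral_swap
          hm.aemeasurable]
        congr 1
        refine lintegral_congr fun x => ?_
        rw [lintegral_const_mul]
        exact Measurable.indicator (by fun_prop) (measurableSet_lt (by fun_prop) (by fun_prop))
    _ = D * (2 ^ (q - 1) / ENNReal.ofReal (q - 1)) * ∫⁻ x, h x ^ q ∂μ := by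
        rw [mul_assoc D, ← lintegral_const_mul _ (hh.pow_const q)]
        congr 1
        refine lintegral_congr fun x => ?_
        rw [setLIntegral_lt_rpow (by linarith), ENNReal.mul_rpow_of_nonneg _ _ (by linarith)]
        rw [← ENNReal.mul_rpow_sub_one_self hq.le, div_eq_mul_inv, div_eq_mul_inv]
        ring

end MaximalFunction

section Cones

variable {E : Type*} [NormedAddCommGroup E] [MeasurableSpace E]

/-- The mass that a measure on `ℝ × E` gives to the cone of aperture `α` with vertex `x`. -/
def coneMass (ν : Measure (ℝ × E)) (α : ℝ) (x : E) : ℝ≥0∞ :=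
  ν {z | z.2 ∈ ball x (α * z.1)}

variable [BorelSpace E] [NormedSpace ℝ E] [FiniteDimensional ℝ E]

lemma measurableSet_cones (α : ℝ) :
    MeasurableSet {w : E × (ℝ × E) | w.2.2 ∈ ball w.1 (α * w.2.1)} :=
  measurableSet_lt (f := fun w : E × (ℝ × E) => dist w.2.2 w.1) (by fun_prop) (by fun_prop)

variable (ν : Measure (ℝ × E)) [SFinite ν]

lemma measurable_coneMass (α : ℝ) : Measurable (coneMass ν α) :=
  measurable_measure_prodMk_left (measurableSet_cones α)

variable (μ : Measure E) [μ.IsAddHaarMeasure]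

lemma lintegral_coneMass_mul (α : ℝ) {h : E → ℝ≥0∞} (hh : Measurable h) :
    ∫⁻ x, coneMass ν α x * h x ∂μ = ∫⁻ z, (∫⁻ x in ball z.2 (α * z.1), h x ∂μ) ∂ν := by
  have hm : Measurable (Function.uncurry fun (x : E) (z : ℝ × E) =>
      (ball z.2 (α * z.1)).indicator h x) := by
    have := (hh.comp measurable_fst).indicator (measurableSet_cones (E := E) α)
    convert this using 1
    ext w
    simp only [Function.uncurry, indicator, mem_ofPred_eq, mem_ball, dist_comm, Function.comp]
  calc ∫⁻ x, coneMass ν α x * h x ∂μ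
      = ∫⁻ x, (∫⁻ z, (ball z.2 (α * z.1)).indicator h x ∂ν) ∂μ := by
        refine lintegral_congr fun x => ?_
        have : ∀ z : ℝ × E, (ball z.2 (α * z.1)).indicator h x =
            {z : ℝ × E | z.2 ∈ ball x (α * z.1)}.indicator (fun _ => h x) z := by
          intro z
          simp only [indicator, mem_ofPred_eq, mem_ball, dist_comm]
        have hS : MeasurableSet {z : ℝ × E | z.2 ∈ ball x (α * z.1)} :=
          measurable_prodMk_left (x := x) (measurableSet_cones α)
        simp_rw [this]
        rw [lintegral_indicator_const hS, mul_comm]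
        rfl
    _ = ∫⁻ z, (∫⁻ x, (ball z.2 (α * z.1)).indicator h x ∂μ) ∂ν :=
        lintegral_lintegral_swap hm.aemeasurable
    _ = _ := by simp_rw [lintegral_indicator measurableSet_ball]

lemma lintegral_coneMass_mul_le {α : ℝ} (hα : 1 ≤ α) {h : E → ℝ≥0∞} (hh : Measurable h) :
    ∫⁻ x, coneMass ν α x * h x ∂μ ≤
      ENNReal.ofReal (α ^ finrank ℝ E) * ∫⁻ x, coneMass ν 1 x * maximalFn μ h x ∂μ := by
  rw [lintegral_coneMass_mul ν μ α hh, lintegral_coneMass_mul ν μ 1 (measurable_maximalFn μ h),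
    ← lintegral_const_mul' _ _ (by simp)]
  refine lintegral_mono fun ⟨t, y⟩ => ?_
  rcases le_or_gt t 0 with ht | ht
  · rw [ball_eq_empty.2 (by nlinarith)]
    simp
  simp only [one_mul]
  have h0 : μ (ball y t) ≠ 0 := (measure_ball_pos μ y ht).ne'
  have htop : μ (ball y t) ≠ ∞ := measure_ball_lt_top.ne
  refine (ENNReal.mul_le_mul_iff_left (c := μ (ball y t)) h0 htop).1 ?_
  rw [← setLIntegral_const, ← lintegral_const_mul' _ _ (by simp),
    ← lintegral_mul_const' _ _ htop]
  refine setLIntegral_mono' measurableSet_ball fun x hx => ?_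
  refine (setLIntegral_ball_le_mul_maximalFn μ
    (ball_subset_ball (by nlinarith) hx)).trans (le_of_eq ?_)
  rw [Measure.addHaar_ball_mul_of_pos μ y (by linarith), Measure.addHaar_ball_center μ y]
  ring

variable [Nontrivial E]

/-- A distributional inequality between conical functionals of different apertures. -/
lemma mul_measure_lt_coneMass_le {α : ℝ} (hα : 1 ≤ α) {s : ℝ≥0∞} :
    s * μ {x | s < coneMass ν α x} ≤
      4 * ENNReal.ofReal (5 ^ finrank ℝ E) * ENNReal.ofReal (α ^ finrank ℝ E) *
        (s * μ {x | s < coneMass ν 1 x} +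
          ∫⁻ x, coneMass ν 1 x * {x | coneMass ν 1 x ≤ s}.indicator 1 x ∂μ) := by
  set A := ENNReal.ofReal (α ^ finrank ℝ E) with hA
  set K := ENNReal.ofReal (5 ^ finrank ℝ E) with hK
  have hA0 : A ≠ 0 := by
    have : 0 < α ^ finrank ℝ E := by positivity
    simpa [hA] using this
  have hAt : A ≠ ∞ := by simp [hA]
  have hK1 : 1 ≤ K := by
    rw [hK, ENNReal.one_le_ofReal]
    exact one_le_pow₀ (by norm_num)
  set S := {x | s < coneMass ν 1 x} with hS
  have hSm : MeasurableSet S := measurableSet_lt measurable_const (measurable_coneMass ν 1)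
  set f : E → ℝ≥0∞ := S.indicator 1 with hf
  set θ := (2 * A)⁻¹ with hθ
  have hθ0 : θ ≠ 0 := by simp [hθ, hAt, ENNReal.mul_eq_top]
  have hθt : θ ≠ ∞ := by simp [hθ, hA0]
  set O := {x | θ < maximalFn μ f x} with hO
  have hOm : MeasurableSet O := measurableSet_lt measurable_const (measurable_maximalFn μ f)
  have hOle : μ O ≤ 4 * K * A * μ S := by
    have h1 : θ * μ O ≤ 2 * K * μ S := by
      refine (mul_measure_lt_maximalFn_le μ hθ0 hθt).trans ?_
      gcongr
      rw [← lintegral_indicator_one hSm]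
      exact lintegral_mono fun x => indicator_le_self _ _ x
    calc μ O = 2 * A * (θ * μ O) := by
          rw [← mul_assoc, hθ, ENNReal.mul_inv_cancel (by simp [hA0])
            (ENNReal.mul_ne_top (by simp) hAt), one_mul]
      _ ≤ 2 * A * (2 * K * μ S) := by gcongr
      _ = 4 * K * A * μ S := by ring
  have hcompl : ∫⁻ x, coneMass ν α x * Oᶜ.indicator 1 x ∂μ ≤
      2 * A * ∫⁻ x, coneMass ν 1 x * Sᶜ.indicator 1 x ∂μ := by
    rw [lintegral_coneMass_mul ν μ α (measurable_one.indicator hOm.compl),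
      lintegral_coneMass_mul ν μ 1 (measurable_one.indicator hSm.compl),
      ← lintegral_const_mul' _ _ (ENNReal.mul_ne_top (by simp) hAt)]
    refine lintegral_mono fun ⟨t, y⟩ => ?_
    simp only [one_mul, lintegral_indicator_one hOm.compl, lintegral_indicator_one hSm.compl,
      Measure.restrict_apply hOm.compl, Measure.restrict_apply hSm.compl]
    rcases (Oᶜ ∩ ball y (α * t)).eq_empty_or_nonempty with he | ⟨x, hxO, hx⟩
    · simp [he]
    have ht : 0 < t := by
      have := pos_of_mem_ball hx
      exact pos_of_mul_pos_right this (by linarith)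
    have htop : μ (ball y t) ≠ ∞ := measure_ball_lt_top.ne
    have hball : μ (ball y (α * t)) = A * μ (ball y t) := by
      rw [Measure.addHaar_ball_mul_of_pos μ y (by linarith), Measure.addHaar_ball_center μ y]
    have h1 : μ (S ∩ ball y t) ≤ μ (ball y t) / 2 := by
      calc μ (S ∩ ball y t) ≤ μ (S ∩ ball y (α * t)) := by
            gcongr
            nlinarith
        _ = ∫⁻ z in ball y (α * t), f z ∂μ := by
            rw [hf, lintegral_indicator_one hSm, Measure.restrict_apply hSm]
        _ ≤ μ (ball y (α * t)) * θ :=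
            (setLIntegral_ball_le_mul_maximalFn μ hx).trans (by gcongr; exact not_lt.1 hxO)
        _ = μ (ball y t) / 2 := by
            rw [hball, hθ, ENNReal.mul_inv (by simp) (by simp), div_eq_mul_inv]
            calc _ = (A * A⁻¹) * (μ (ball y t) * 2⁻¹) := by ring
              _ = _ := by rw [ENNReal.mul_inv_cancel hA0 hAt, one_mul]
    have h2 : μ (ball y t) ≤ 2 * μ (Sᶜ ∩ ball y t) := by
      have h3 : μ (ball y t) / 2 + μ (ball y t) / 2 ≤ μ (ball y t) / 2 + μ (Sᶜ ∩ ball y t) := by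
        rw [ENNReal.add_halves]
        calc μ (ball y t) ≤ μ (S ∩ ball y t) + μ (Sᶜ ∩ ball y t) := by
              refine (measure_mono fun z hz => ?_).trans (measure_union_le _ _)
              by_cases hzS : z ∈ S
              · exact Or.inl ⟨hzS, hz⟩
              · exact Or.inr ⟨hzS, hz⟩
          _ ≤ _ := by gcongr
      have h4 := (ENNReal.add_le_add_iff_left (ENNReal.div_ne_top htop (by simp))).1 h3
      rwa [ENNReal.div_le_iff' (by simp) (by simp)] at h4
    calc μ (Oᶜ ∩ ball y (α * t)) ≤ A * μ (ball y t) :=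
          (measure_mono inter_subset_right).trans hball.le
      _ ≤ A * (2 * μ (Sᶜ ∩ ball y t)) := by gcongr
      _ = _ := by ring
  have hSc : Sᶜ = {x | coneMass ν 1 x ≤ s} := by
    ext x
    simp [hS]
  have hcheb : s * μ ({x | s < coneMass ν α x} ∩ Oᶜ) ≤
      ∫⁻ x, coneMass ν α x * Oᶜ.indicator 1 x ∂μ := by
    rw [← lintegral_indicator_const
      ((measurableSet_lt measurable_const (measurable_coneMass ν α)).inter hOm.compl)]
    refine lintegral_mono fun x => ?_
    by_cases hx : x ∈ {x | s < coneMass ν α x} ∩ Oᶜ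
    · rw [indicator_of_mem hx, indicator_of_mem hx.2]
      simpa using hx.1.le
    · rw [indicator_of_notMem hx]
      exact zero_le
  calc s * μ {x | s < coneMass ν α x}
      ≤ s * (μ O + μ ({x | s < coneMass ν α x} ∩ Oᶜ)) := by
        gcongr
        refine (measure_mono fun z hz => ?_).trans (measure_union_le _ _)
        by_cases hzO : z ∈ O
        · exact Or.inl hzO
        · exact Or.inr ⟨hz, hzO⟩
    _ ≤ s * (4 * K * A * μ S) + 2 * A * ∫⁻ x, coneMass ν 1 x * Sᶜ.indicator 1 x ∂μ := by
        rw [mul_add]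
        exact add_le_add (mul_le_mul' le_rfl hOle) (hcheb.trans hcompl)
    _ ≤ s * (4 * K * A * μ S) + 4 * K * A * ∫⁻ x, coneMass ν 1 x * Sᶜ.indicator 1 x ∂μ := by
        gcongr
        calc (2 : ℝ≥0∞) ≤ 4 * 1 := by norm_num
          _ ≤ 4 * K := by gcongr
    _ = _ := by
        rw [hSc]
        ring

/-- Change of aperture in `L^q` for `0 < q < 1`. -/
lemma lintegral_coneMass_rpow_le_of_lt_one {q : ℝ} (hq : 0 < q) (hq1 : q < 1) {α : ℝ}
    (hα : 1 ≤ α) :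
    ∫⁻ x, coneMass ν α x ^ q ∂μ ≤
      4 * ENNReal.ofReal (5 ^ finrank ℝ E) * (1 + ENNReal.ofReal q / ENNReal.ofReal (1 - q)) *
        (ENNReal.ofReal (α ^ finrank ℝ E) * ∫⁻ x, coneMass ν 1 x ^ q ∂μ) := by
  set A := ENNReal.ofReal (α ^ finrank ℝ E) with hA
  set K := 4 * ENNReal.ofReal (5 ^ finrank ℝ E) with hK
  have hKt : K * A ≠ ∞ := by finiteness
  set a := coneMass ν 1 with ha
  have ham : Measurable a := measurable_coneMass ν 1
  have hm : Measurable (Function.uncurry fun (x : E) (s : ℝ) => a x *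
      {s : ℝ | a x ≤ ENNReal.ofReal s}.indicator (fun s => ENNReal.ofReal (s ^ (q - 2))) s) := by
    have h1 : Measurable fun z : E × ℝ => ENNReal.ofReal (z.2 ^ (q - 2)) := by fun_prop
    have h2 : MeasurableSet {z : E × ℝ | a z.1 ≤ ENNReal.ofReal z.2} :=
      measurableSet_le (by fun_prop) (by fun_prop)
    exact (ham.comp measurable_fst).mul (h1.indicator h2)
  have hlow : Measurable fun s : ℝ =>
      ENNReal.ofReal (s ^ (q - 1)) * μ {x | ENNReal.ofReal s < a x} := by
    have h2 : MeasurableSet {z : ℝ × E | ENNReal.ofReal z.1 < a z.2} :=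
      measurableSet_lt (by fun_prop) (by fun_prop)
    exact Measurable.mul (by fun_prop) (measurable_measure_prodMk_left h2)
  have hpt : ∀ s : ℝ, 0 < s → ENNReal.ofReal (s ^ (q - 1)) *
      μ {x | ENNReal.ofReal s < coneMass ν α x} ≤
      K * A * (ENNReal.ofReal (s ^ (q - 1)) * μ {x | ENNReal.ofReal s < a x} +
        ∫⁻ x, a x * {s : ℝ | a x ≤ ENNReal.ofReal s}.indicator
          (fun s => ENNReal.ofReal (s ^ (q - 2))) s ∂μ) := by
    intro s hs
    have h1 : ENNReal.ofReal (s ^ (q - 1)) = ENNReal.ofReal (s ^ (q - 2)) * ENNReal.ofReal s := by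
      rw [← ENNReal.ofReal_mul (by positivity), show q - 2 = q - 1 - 1 by ring,
        Real.rpow_sub_one hs.ne' (q - 1), div_mul_cancel₀ _ hs.ne']
    have h2 : ∫⁻ x, a x * {s : ℝ | a x ≤ ENNReal.ofReal s}.indicator
          (fun s => ENNReal.ofReal (s ^ (q - 2))) s ∂μ = ENNReal.ofReal (s ^ (q - 2)) *
        ∫⁻ x, a x * {x | a x ≤ ENNReal.ofReal s}.indicator 1 x ∂μ := by
      rw [← lintegral_const_mul' _ _ (by simp)]
      refine lintegral_congr fun x => ?_
      simp only [indicator, mem_ofPred_eq]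
      split_ifs <;> simp [mul_comm]
    rw [h2, h1, mul_assoc (ENNReal.ofReal (s ^ (q - 2))), mul_assoc (ENNReal.ofReal (s ^ (q - 2))),
      ← mul_add, mul_left_comm (K * A)]
    exact mul_le_mul' le_rfl (mul_measure_lt_coneMass_le ν μ hα)
  rw [lintegral_rpow_eq_layercake (measurable_coneMass ν α) hq]
  calc _ ≤ ENNReal.ofReal q * ∫⁻ s in Ioi (0 : ℝ),
        K * A * (ENNReal.ofReal (s ^ (q - 1)) * μ {x | ENNReal.ofReal s < a x} +
        ∫⁻ x, a x * {s : ℝ | a x ≤ ENNReal.ofReal s}.indicator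
          (fun s => ENNReal.ofReal (s ^ (q - 2))) s ∂μ) := by
        gcongr ENNReal.ofReal q * ?_
        exact setLIntegral_mono' measurableSet_Ioi hpt
    _ = K * A * (∫⁻ x, a x ^ q ∂μ + ENNReal.ofReal q * ∫⁻ x, a x *
          (∫⁻ s in Ioi (0 : ℝ), {s : ℝ | a x ≤ ENNReal.ofReal s}.indicator
            (fun s => ENNReal.ofReal (s ^ (q - 2))) s) ∂μ) := by
        rw [lintegral_const_mul' _ _ hKt, lintegral_add_left hlow,
          lintegral_rpow_eq_layercake ham hq, ← lintegral_lintegral_swap hm.aemeasurable,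
          ← mul_add, mul_left_comm (K * A)]
        congr 4
        funext x
        rw [lintegral_const_mul]
        exact Measurable.indicator (by fun_prop) (measurableSet_le (by fun_prop) (by fun_prop))
    _ ≤ K * A * (∫⁻ x, a x ^ q ∂μ + ENNReal.ofReal q *
          ∫⁻ x, a x ^ q / ENNReal.ofReal (1 - q) ∂μ) := by
        gcongr with x
        exact mul_setLIntegral_ge_rpow hq1 (a x)
    _ = _ := by
        simp_rw [div_eq_mul_inv]
        rw [lintegral_mul_const' _ _ (by simpa using hq1)]
        ring

/-- Change of aperture in `L^q` for `0 < q ≤ 1`, with the sharp power of the aperture. -/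
lemma exists_lintegral_coneMass_rpow_le {q : ℝ} (hq : 0 < q) (hq1 : q ≤ 1) :
    ∃ C : ℝ≥0∞, C ≠ ∞ ∧ ∀ ν : Measure (ℝ × E), SFinite ν → ∀ α : ℝ, 1 ≤ α →
      ∫⁻ x, coneMass ν α x ^ q ∂μ ≤
        C * (ENNReal.ofReal (α ^ finrank ℝ E) * ∫⁻ x, coneMass ν 1 x ^ q ∂μ) := by
  rcases hq1.lt_or_eq with hq1 | rfl
  · refine ⟨_, ?_, fun ν _ α hα => lintegral_coneMass_rpow_le_of_lt_one ν μ hq hq1 hα⟩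
    have : ENNReal.ofReal q / ENNReal.ofReal (1 - q) ≠ ∞ :=
      ENNReal.div_ne_top (by simp) (by simpa using hq1)
    finiteness
  · refine ⟨1, by simp, fun ν _ α hα => ?_⟩
    have h1 := lintegral_coneMass_mul ν μ α (h := 1) measurable_one
    have h2 := lintegral_coneMass_mul ν μ 1 (h := 1) measurable_one
    simp only [Pi.one_apply, mul_one] at h1 h2
    simp only [ENNReal.rpow_one, one_mul]
    rw [h1, h2, ← lintegral_const_mul' _ _ (by simp)]
    refine le_of_eq (lintegral_congr fun z => ?_)
    rw [setLIntegral_one, setLIntegral_one, Measure.addHaar_ball_mul_of_pos μ _ (by linarith),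
      one_mul, Measure.addHaar_ball_center μ z.2]

lemma ofReal_two_pow_pow (d j : ℕ) :
    ENNReal.ofReal (((2 : ℝ) ^ j) ^ d) = (2 ^ d : ℝ≥0∞) ^ j := by
  rw [← pow_mul, mul_comm, pow_mul, ENNReal.ofReal_pow (by positivity),
    ENNReal.ofReal_pow (by positivity)]
  simp

/-- Dyadic superpositions of conical functionals are controlled in `L^q` by the functional of
aperture one. -/
theorem exists_lintegral_tsum_coneMass_rpow_le {q : ℝ} (hq : 0 < q) {W : ℝ≥0∞}
    (hW : W * 2 ^ finrank ℝ E < 1) (hWq : W ^ q * 2 ^ finrank ℝ E < 1) :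
    ∃ C : ℝ≥0∞, C ≠ ∞ ∧ ∀ ν : Measure (ℝ × E), SFinite ν →
      ∫⁻ x, (∑' j : ℕ, W ^ j * coneMass ν (2 ^ j) x) ^ q ∂μ ≤ C * ∫⁻ x, coneMass ν 1 x ^ q ∂μ := by
  have hj : ∀ j : ℕ, (1 : ℝ) ≤ 2 ^ j := fun j => one_le_pow₀ (by norm_num)
  rcases le_or_gt q 1 with hq1 | hq1
  · obtain ⟨C, hC, h⟩ := exists_lintegral_coneMass_rpow_le μ hq hq1
    refine ⟨C * (1 - W ^ q * 2 ^ finrank ℝ E)⁻¹,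
      ENNReal.mul_ne_top hC (by simpa [tsub_eq_zero_iff_le] using hWq), fun ν hν => ?_⟩
    calc _ ≤ ∫⁻ x, ∑' j : ℕ, (W ^ j * coneMass ν (2 ^ j) x) ^ q ∂μ :=
          lintegral_mono fun x => ENNReal.rpow_tsum_le_tsum_rpow hq hq1 _
      _ = ∑' j : ℕ, (W ^ q) ^ j * ∫⁻ x, coneMass ν (2 ^ j) x ^ q ∂μ := by
          rw [lintegral_tsum fun j =>
            (((measurable_coneMass ν _).const_mul _).pow_const _).aemeasurable]
          congr 1 with j
          rw [← lintegral_const_mul _ ((measurable_coneMass ν _).pow_const _)]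
          refine lintegral_congr fun x => ?_
          rw [ENNReal.mul_rpow_of_nonneg _ _ hq.le, ← ENNReal.rpow_natCast, ← ENNReal.rpow_natCast,
            ← ENNReal.rpow_mul, ← ENNReal.rpow_mul, mul_comm q]
      _ ≤ ∑' j : ℕ, (W ^ q) ^ j * (C * ((2 ^ finrank ℝ E) ^ j * ∫⁻ x, coneMass ν 1 x ^ q ∂μ)) := by
          gcongr with j
          rw [← ofReal_two_pow_pow]
          exact h ν hν _ (hj j)
      _ = ∑' j : ℕ, (W ^ q * 2 ^ finrank ℝ E) ^ j * (C * ∫⁻ x, coneMass ν 1 x ^ q ∂μ) := by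
          congr 1 with j
          rw [mul_pow]
          ring
      _ = _ := by
          rw [ENNReal.tsum_mul_right, ENNReal.tsum_geometric]
          ring
  · set q' := q.conjExponent with hq'
    have hqq : q.HolderConjugate q' := Real.HolderConjugate.conjExponent hq1
    obtain ⟨C, hC, hmax⟩ := lintegral_maximalFn_rpow_le μ hqq.symm.lt
    set D := (1 - W * 2 ^ finrank ℝ E)⁻¹ with hD
    have hDt : D ≠ ∞ := by simpa [hD, tsub_eq_zero_iff_le] using hW
    have hq'0 : 0 < q' := hqq.symm.pos
    refine ⟨(D * C ^ (1 / q')) ^ q, by finiteness, fun ν hν => ?_⟩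
    set a := coneMass ν 1 with ha
    have ham : Measurable a := measurable_coneMass ν 1
    have hGm : Measurable fun x => ∑' j : ℕ, W ^ j * coneMass ν (2 ^ j) x :=
      Measurable.tsum fun j => (measurable_coneMass ν _).const_mul _
    have key : ∀ h : E → ℝ≥0∞, Measurable h →
        ∫⁻ x, (∑' j : ℕ, W ^ j * coneMass ν (2 ^ j) x) * h x ∂μ ≤
          D * C ^ (1 / q') * (∫⁻ x, a x ^ q ∂μ) ^ (1 / q) * (∫⁻ x, h x ^ q' ∂μ) ^ (1 / q') := by
      intro h hh
      calc _ = ∑' j : ℕ, W ^ j * ∫⁻ x, coneMass ν (2 ^ j) x * h x ∂μ := by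
            simp_rw [← ENNReal.tsum_mul_right]
            have hm : ∀ j : ℕ, Measurable fun x => W ^ j * coneMass ν (2 ^ j) x * h x := fun j =>
              ((measurable_coneMass ν _).const_mul _).mul hh
            rw [lintegral_tsum fun j => (hm j).aemeasurable]
            congr 1 with j
            have hmj : Measurable fun x => coneMass ν (2 ^ j) x * h x :=
              (measurable_coneMass ν _).mul hh
            rw [← lintegral_const_mul _ hmj]
            simp_rw [mul_assoc]
        _ ≤ ∑' j : ℕ, W ^ j * ((2 ^ finrank ℝ E) ^ j * ∫⁻ x, a x * maximalFn μ h x ∂μ) := by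
            gcongr with j
            rw [← ofReal_two_pow_pow]
            exact lintegral_coneMass_mul_le ν μ (hj j) hh
        _ = D * ∫⁻ x, a x * maximalFn μ h x ∂μ := by
            rw [hD, ← ENNReal.tsum_geometric, ← ENNReal.tsum_mul_right]
            congr 1 with j
            rw [mul_pow]
            ring
        _ ≤ D * ((∫⁻ x, a x ^ q ∂μ) ^ (1 / q) * (∫⁻ x, maximalFn μ h x ^ q' ∂μ) ^ (1 / q')) := by
            gcongr
            exact ENNReal.lintegral_mul_le_Lp_mul_Lq μ hqq ham.aemeasurable
              (measurable_maximalFn μ h).aemeasurable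
        _ ≤ D * ((∫⁻ x, a x ^ q ∂μ) ^ (1 / q) * (C * ∫⁻ x, h x ^ q' ∂μ) ^ (1 / q')) := by
            gcongr
            exact hmax h hh
        _ = _ := by
            rw [ENNReal.mul_rpow_of_nonneg _ _ (by positivity)]
            ring
    refine (lintegral_rpow_le_of_forall_mul_le hqq hGm key).trans (le_of_eq ?_)
    rw [ENNReal.mul_rpow_of_nonneg _ _ hq.le, ← ENNReal.rpow_mul, one_div_mul_cancel hq.ne',
      ENNReal.rpow_one]

end Cones

section GrandSquareFunction

/-- The measure `|g(t,y)|² dy dt / t^{n+1}` on the upper half-space. -/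
def tentMeasure (n : ℕ) (g : ℝ → En n → ℝ) : Measure (ℝ × En n) :=
  ((volume.restrict (Ioi (0 : ℝ))).prod volume).withDensity
    fun z => ENNReal.ofReal (|g z.1 z.2| ^ 2 / z.1 ^ (n + 1))

instance (n : ℕ) (g : ℝ → En n → ℝ) : SFinite (tentMeasure n g) := by
  unfold tentMeasure
  infer_instance

lemma measurable_tentDensity {n : ℕ} {g : ℝ → En n → ℝ} (hg : Measurable (Function.uncurry g)) :
    Measurable fun z : ℝ × En n => ENNReal.ofReal (|g z.1 z.2| ^ 2 / z.1 ^ (n + 1)) := by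
  have : Measurable fun z : ℝ × En n => g z.1 z.2 := hg
  fun_prop

lemma coneMass_tentMeasure {n : ℕ} {g : ℝ → En n → ℝ} (hg : Measurable (Function.uncurry g))
    (α : ℝ) (x : En n) :
    coneMass (tentMeasure n g) α x = ∫⁻ t in Ioi (0 : ℝ), ∫⁻ y,
      (ball x (α * t)).indicator (fun y => ENNReal.ofReal (|g t y| ^ 2 / t ^ (n + 1))) y := by
  have hS : MeasurableSet {z : ℝ × En n | z.2 ∈ ball x (α * z.1)} :=
    measurable_prodMk_left (x := x) (measurableSet_cones α)
  rw [coneMass, tentMeasure, withDensity_apply _ hS, ← lintegral_indicator hS,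
    lintegral_prod _ ((measurable_tentDensity hg).indicator hS).aemeasurable]
  rfl

/-- The weight of the grand square function is dominated by a dyadic sum of indicators of cones. -/
lemma ofReal_weight_le_tsum {t d N : ℝ} (ht : 0 < t) (hd : 0 ≤ d) (hN : 0 ≤ N) :
    ENNReal.ofReal ((t / (d + t)) ^ N) ≤ ENNReal.ofReal (2 ^ N) *
      ∑' j : ℕ, ENNReal.ofReal (2 ^ (-N)) ^ j * {j : ℕ | d < 2 ^ j * t}.indicator 1 j := by
  have hex : ∃ j : ℕ, d < 2 ^ j * t := by
    obtain ⟨j, hj⟩ := pow_unbounded_of_one_lt (d / t) (one_lt_two)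
    exact ⟨j, (div_lt_iff₀ ht).1 hj⟩
  classical
  set k := Nat.find hex with hk
  have hkd : d < 2 ^ k * t := Nat.find_spec hex
  have hbase : t / (d + t) ≤ 2 * ((2 : ℝ) ^ k)⁻¹ := by
    rw [div_le_iff₀ (by linarith)]
    rcases Nat.eq_zero_or_pos k with h0 | h0
    · rw [h0]
      simp
      linarith
    · have h1 : ¬ d < 2 ^ (k - 1) * t := Nat.find_min hex (by omega)
      obtain ⟨m, hm⟩ : ∃ m, k = m + 1 := ⟨k - 1, by omega⟩
      rw [hm] at h1 ⊢
      simp only [Nat.add_sub_cancel, not_lt] at h1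
      rw [pow_succ]
      have h2 : (0 : ℝ) < 2 ^ m := by positivity
      field_simp
      linarith
  refine le_trans ?_ (mul_le_mul' le_rfl (ENNReal.le_tsum k))
  rw [indicator_of_mem (by exact hkd), Pi.one_apply, mul_one, ← ENNReal.ofReal_pow (by positivity),
    ← ENNReal.ofReal_mul (by positivity)]
  apply ENNReal.ofReal_le_ofReal
  calc (t / (d + t)) ^ N ≤ (2 * ((2 : ℝ) ^ k)⁻¹) ^ N := by
        apply Real.rpow_le_rpow (by positivity) hbase hN
    _ = 2 ^ N * (2 ^ (-N)) ^ k := by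
        rw [Real.mul_rpow (by norm_num) (by positivity), Real.inv_rpow (by positivity),
          Real.rpow_neg (by norm_num), inv_pow, ← Real.rpow_natCast, ← Real.rpow_natCast,
          ← Real.rpow_mul (by norm_num), ← Real.rpow_mul (by norm_num), mul_comm N]

lemma grandSq_integral_le {n : ℕ} {l : ℝ} (hl : 0 ≤ l) {g : ℝ → En n → ℝ}
    (hg : Measurable (Function.uncurry g)) (x : En n) :
    ∫⁻ t in Ioi (0 : ℝ), ∫⁻ y, ENNReal.ofReal
        ((t / (dist x y + t)) ^ ((n : ℝ) * l) * |g t y| ^ 2 / t ^ (n + 1)) ≤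
      ENNReal.ofReal (2 ^ ((n : ℝ) * l)) * ∑' j : ℕ, ENNReal.ofReal (2 ^ (-((n : ℝ) * l))) ^ j *
        coneMass (tentMeasure n g) (2 ^ j) x := by
  set N := (n : ℝ) * l with hN
  have hN0 : 0 ≤ N := by positivity
  set F : ℝ × En n → ℝ≥0∞ := fun z => ENNReal.ofReal (|g z.1 z.2| ^ 2 / z.1 ^ (n + 1)) with hF
  have hFm : Measurable F := measurable_tentDensity hg
  have hS : ∀ j : ℕ, MeasurableSet {z : ℝ × En n | z.2 ∈ ball x (2 ^ j * z.1)} := fun j =>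
    measurable_prodMk_left (x := x) (measurableSet_cones (2 ^ j))
  have hm : ∀ j : ℕ, Measurable fun z : ℝ × En n => ENNReal.ofReal (2 ^ (-N)) ^ j *
      {z : ℝ × En n | z.2 ∈ ball x (2 ^ j * z.1)}.indicator F z := fun j =>
    (hFm.indicator (hS j)).const_mul _
  calc _ ≤ ∫⁻ t in Ioi (0 : ℝ), ∫⁻ y, ENNReal.ofReal (2 ^ N) * ∑' j : ℕ,
          ENNReal.ofReal (2 ^ (-N)) ^ j *
            {z : ℝ × En n | z.2 ∈ ball x (2 ^ j * z.1)}.indicator F (t, y) := by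
        refine setLIntegral_mono' measurableSet_Ioi fun t (ht : 0 < t) =>
          lintegral_mono fun y => ?_
        have h1 := ofReal_weight_le_tsum ht (dist_nonneg (x := x) (y := y)) hN0
        rw [mul_div_assoc, ENNReal.ofReal_mul (by positivity)]
        refine (mul_le_mul' h1 (le_refl (F (t, y)))).trans (le_of_eq ?_)
        rw [mul_assoc, ← ENNReal.tsum_mul_right]
        congr 2 with j
        simp only [indicator, mem_ofPred_eq, mem_ball, dist_comm, Pi.one_apply]
        split_ifs <;> simp
    _ = ENNReal.ofReal (2 ^ N) * ∫⁻ z, ∑' j : ℕ, ENNReal.ofReal (2 ^ (-N)) ^ j *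
          {z : ℝ × En n | z.2 ∈ ball x (2 ^ j * z.1)}.indicator F z
            ∂((volume.restrict (Ioi (0 : ℝ))).prod volume) := by
        rw [lintegral_prod _ (Measurable.tsum hm).aemeasurable,
          ← lintegral_const_mul' _ _ (by simp)]
        refine lintegral_congr fun t => ?_
        rw [lintegral_const_mul' _ _ (by simp)]
    _ = _ := by
        rw [lintegral_tsum fun j => (hm j).aemeasurable]
        congr 2 with j
        rw [lintegral_const_mul _ (hFm.indicator (hS j)), coneMass, tentMeasure,
          withDensity_apply _ (hS j), lintegral_indicator (hS j)]

lemma ofReal_two_rpow_mul_lt_one {n : ℕ} (hn : 1 ≤ n) {r : ℝ} (hr : 1 < r) :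
    ENNReal.ofReal (2 ^ (-((n : ℝ) * r))) * 2 ^ n < 1 := by
  have h2 : (2 ^ n : ℝ≥0∞) = ENNReal.ofReal (2 ^ (n : ℝ)) := by
    rw [Real.rpow_natCast, ENNReal.ofReal_pow (by norm_num)]
    simp
  have hn' : (1 : ℝ) ≤ n := by exact_mod_cast hn
  rw [h2, ← ENNReal.ofReal_mul (by positivity), ← Real.rpow_add (by norm_num),
    ENNReal.ofReal_lt_one]
  exact Real.rpow_lt_one_of_one_lt_of_neg (by norm_num) (by nlinarith)

end GrandSquareFunction

/-- (Corollary on the grand square function.) For `λ > max(2/p, 1)` there is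
`C = C(n,p,λ) > 0` such that `‖G_λ g‖_p ≤ C ‖A^{(1)}g‖_p`. -/
theorem statement11 (n : ℕ) (hn : 1 ≤ n) (p l : ℝ) (hp : 0 < p)
    (hl : max (2 / p) 1 < l) :
    ∃ C : ℝ, 0 < C ∧ ∀ g : ℝ → En n → ℝ, LocSqInt n g →
      (∫⁻ x, grandSq n l g x ^ p) ^ (1 / p) ≤ ENNReal.ofReal C * tentNorm n p 1 g := by
  have hl1 : 1 < l := (le_max_right _ _).trans_lt hl
  have hlp : 1 < l * (p / 2) := by
    have h1 : 2 / p < l := (le_max_left _ _).trans_lt hl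
    rw [div_lt_iff₀ hp] at h1
    linarith
  have hq : 0 < p / 2 := by positivity
  have : Nonempty (Fin n) := ⟨⟨0, hn⟩⟩
  set N := (n : ℝ) * l with hN
  set W := ENNReal.ofReal (2 ^ (-N)) with hW
  have hfr : finrank ℝ (En n) = n := finrank_euclideanSpace_fin
  have hWq : W ^ (p / 2) * 2 ^ n < 1 := by
    rw [hW, ENNReal.ofReal_rpow_of_pos (by positivity), ← Real.rpow_mul (by norm_num),
      show -N * (p / 2) = -((n : ℝ) * (l * (p / 2))) by rw [hN]; ring]
    exact ofReal_two_rpow_mul_lt_one hn hlp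
  obtain ⟨C, hC, h⟩ := exists_lintegral_tsum_coneMass_rpow_le (volume : Measure (En n)) hq
    (W := W) (by rw [hfr]; exact ofReal_two_rpow_mul_lt_one hn hl1) (by rwa [hfr])
  set B := (ENNReal.ofReal (2 ^ N) ^ (p / 2) * C) ^ (1 / p) with hB
  have hBt : B ≠ ∞ := by finiteness
  refine ⟨B.toReal + 1, by positivity, fun g hg => ?_⟩
  have hBle : B ≤ ENNReal.ofReal (B.toReal + 1) := by
    rw [ENNReal.le_ofReal_iff_toReal_le hBt (by positivity)]
    linarith
  have hpow : ∀ c : ℝ≥0∞, (c ^ (1 / 2 : ℝ)) ^ p = c ^ (p / 2) := fun c => by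
    rw [← ENNReal.rpow_mul]
    congr 1
    ring
  have hmain : ∫⁻ x, grandSq n l g x ^ p ≤
      ENNReal.ofReal (2 ^ N) ^ (p / 2) * C * ∫⁻ x, conicalSq n 1 g x ^ p := by
    simp only [grandSq, conicalSq, hpow, ← coneMass_tentMeasure hg.1]
    calc _ ≤ ∫⁻ x, ENNReal.ofReal (2 ^ N) ^ (p / 2) *
          (∑' j : ℕ, W ^ j * coneMass (tentMeasure n g) (2 ^ j) x) ^ (p / 2) := by
          refine lintegral_mono fun x => ?_
          rw [← ENNReal.mul_rpow_of_nonneg _ _ hq.le]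
          exact ENNReal.rpow_le_rpow (grandSq_integral_le (by linarith) hg.1 x) hq.le
      _ ≤ _ := by
          rw [lintegral_const_mul' _ _ (by finiteness), mul_assoc]
          gcongr
          exact h _ inferInstance
  calc _ ≤ (ENNReal.ofReal (2 ^ N) ^ (p / 2) * C * ∫⁻ x, conicalSq n 1 g x ^ p) ^ (1 / p) :=
        ENNReal.rpow_le_rpow hmain (by positivity)
    _ = B * tentNorm n p 1 g := by
        rw [ENNReal.mul_rpow_of_nonneg _ _ (by positivity), hB, tentNorm]
    _ ≤ _ := by gcongr

end
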